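/- arXiv:1310.4743 — 5 statements merged into one kernel-verified Lean document; each statement's English description precedes it below -/
import Mathlib

section
/- The morphism h is 2-binomial-cube-free: for every word w over {0,1} that contains no 2-binomial cube as a factor, the word h(w) contains no 2-binomial cube as a factor. -/
/-- Number of occurrences of `v` as a scattered subword (subsequence) of `u`. -/
def binomC {α : Type*} [DecidableEq α] (u v : List α) : ℕ := u.sublists.count v

/-- Two words are 2-binomially equivalent. -/
def binEq2 {α : Type*} [DecidableEq α] (u v : List α) : Prop :=
  ∀ x : List α, x.length ≤ 2 → binomC u x = binomC v x

/-- The morphism h : 0 ↦ 001, 1 ↦ 011. -/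
def h : Fin 2 → List (Fin 2) := ![[0,0,1],[0,1,1]]

/-- Apply the morphism h to a word. -/
def hWord (w : List (Fin 2)) : List (Fin 2) := w.flatMap h

/-- w contains a 2-binomial cube as a factor. -/
def hasBinomialCube (w : List (Fin 2)) : Prop :=
  ∃ u v t : List (Fin 2), u ≠ [] ∧ (u ++ v ++ t) <:+: w ∧ binEq2 u v ∧ binEq2 v t

open Finset in
/-- The sum of the letters of the factor of length `n` starting at position `s`. -/
def letterSum (f : ℕ → ℕ) (s n : ℕ) : ℕ := ∑ i ∈ range n, f (s + i)

open Finset in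
/-- The sum of the letters of the factor of length `n` starting at position `s`,
weighted by their positions in the factor. -/
def positionSum (f : ℕ → ℕ) (s n : ℕ) : ℕ := ∑ i ∈ range n, i * f (s + i)

/-- The letters of a binary word as a sequence of natural numbers, padded with zeros. -/
def letters (w : List (Fin 2)) (i : ℕ) : ℕ := (w.getD i 0 : Fin 2)

lemma letterSum_succ (f : ℕ → ℕ) (s n : ℕ) :
    letterSum f s (n + 1) = letterSum f s n + f (s + n) := Finset.sum_range_succ _ _

lemma positionSum_succ (f : ℕ → ℕ) (s n : ℕ) :
    positionSum f s (n + 1) = positionSum f s n + n * f (s + n) := Finset.sum_range_succ _ _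

lemma letterSum_congr {f g : ℕ → ℕ} {s t n : ℕ} (hfg : ∀ i < n, f (s + i) = g (t + i)) :
    letterSum f s n = letterSum g t n :=
  Finset.sum_congr rfl fun i hi => hfg i (Finset.mem_range.1 hi)

lemma positionSum_congr {f g : ℕ → ℕ} {s t n : ℕ} (hfg : ∀ i < n, f (s + i) = g (t + i)) :
    positionSum f s n = positionSum g t n :=
  Finset.sum_congr rfl fun i hi => by rw [hfg i (Finset.mem_range.1 hi)]

section Binomial

variable {α : Type*} [DecidableEq α]

lemma binomC_nil_right (u : List α) : binomC u [] = 1 := by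
  unfold binomC
  rw [(List.sublists_perm_sublists' u).count_eq]
  induction u with
  | nil => simp
  | cons a u ih =>
    rw [List.sublists'_cons, List.count_append, ih, List.count_eq_zero_of_not_mem]
    simp

lemma binomC_nil_cons (x : α) (v : List α) : binomC [] (x :: v) = 0 := by
  simp [binomC]

lemma binomC_cons_cons (a x : α) (u v : List α) :
    binomC (a :: u) (x :: v) = binomC u (x :: v) + if a = x then binomC u v else 0 := by
  unfold binomC
  simp only [(List.sublists_perm_sublists' _).count_eq]
  rw [List.sublists'_cons, List.count_append]
  congr 1
  split_ifs with hax
  · subst hax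
    exact List.count_map_of_injective _ _ List.cons_injective _
  · rw [List.count_eq_zero_of_not_mem]
    simp [hax]

lemma binomC_pair_self (u : List α) (a : α) : binomC u [a, a] = (binomC u [a]).choose 2 := by
  induction u with
  | nil => simp [binomC_nil_cons]
  | cons b u ih =>
    simp only [binomC_cons_cons, binomC_nil_right, ih]
    split_ifs
    · rw [Nat.choose_succ_succ' _ 1, Nat.choose_one_right, add_comm]
    · rfl

lemma binomC_pair_add_swap (u : List α) {a b : α} (hab : a ≠ b) :
    binomC u [a, b] + binomC u [b, a] = binomC u [a] * binomC u [b] := by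
  induction u with
  | nil => simp [binomC_nil_cons]
  | cons c u ih =>
    simp only [binomC_cons_cons, binomC_nil_right]
    split_ifs with h₁ h₂ h₂
    · exact absurd (h₁.symm.trans h₂) hab
    all_goals linarith

end Binomial

lemma letters_cons_zero (a : Fin 2) (u : List (Fin 2)) : letters (a :: u) 0 = a := rfl

lemma letters_cons_succ (a : Fin 2) (u : List (Fin 2)) (i : ℕ) :
    letters (a :: u) (i + 1) = letters u i := rfl

lemma letterSum_letters_cons (a : Fin 2) (u : List (Fin 2)) (n : ℕ) :
    letterSum (letters (a :: u)) 0 (n + 1) = letterSum (letters u) 0 n + a := by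
  simp [letterSum, Finset.sum_range_succ', letters_cons_zero, letters_cons_succ]

lemma positionSum_letters_cons (a : Fin 2) (u : List (Fin 2)) (n : ℕ) :
    positionSum (letters (a :: u)) 0 (n + 1) =
      positionSum (letters u) 0 n + letterSum (letters u) 0 n := by
  simp [positionSum, letterSum, Finset.sum_range_succ', letters_cons_succ, add_mul,
    Finset.sum_add_distrib]

lemma binomC_zero_add_binomC_one (u : List (Fin 2)) :
    binomC u [0] + binomC u [1] = u.length := by
  induction u with
  | nil => simp [binomC_nil_cons]
  | cons a u ih =>
    simp only [binomC_cons_cons, binomC_nil_right, List.length_cons]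
    fin_cases a <;> simp <;> omega

lemma binomC_one_eq_letterSum (u : List (Fin 2)) :
    binomC u [1] = letterSum (letters u) 0 u.length := by
  induction u with
  | nil => simp [binomC_nil_cons, letterSum]
  | cons a u ih =>
    simp only [binomC_cons_cons, binomC_nil_right, List.length_cons, letterSum_letters_cons, ih]
    fin_cases a <;> simp

lemma binomC_zero_one_add_choose (u : List (Fin 2)) :
    binomC u [0, 1] + (binomC u [1]).choose 2 = positionSum (letters u) 0 u.length := by
  induction u with
  | nil => simp [binomC_nil_cons, positionSum]
  | cons a u ih =>
    simp only [binomC_cons_cons, binomC_nil_right, List.length_cons, positionSum_letters_cons,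
      ← ih, ← binomC_one_eq_letterSum]
    fin_cases a
    · simp
      omega
    · simp [Nat.choose_succ_succ' _ 1]
      omega

/-- Two binary words are 2-binomially equivalent iff they have the same length, the same number
of ones, and the same sum of the positions of the ones. -/
lemma binEq2_iff (u v : List (Fin 2)) :
    binEq2 u v ↔ u.length = v.length ∧
      letterSum (letters u) 0 u.length = letterSum (letters v) 0 v.length ∧
      positionSum (letters u) 0 u.length = positionSum (letters v) 0 v.length := by
  rw [← binomC_one_eq_letterSum, ← binomC_one_eq_letterSum, ← binomC_zero_one_add_choose,
    ← binomC_zero_one_add_choose, ← binomC_zero_add_binomC_one, ← binomC_zero_add_binomC_one]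
  constructor
  · intro huv
    rw [huv [0] (by simp), huv [1] (by simp), huv [0, 1] (by simp)]
    simp
  · rintro ⟨hlen, hone, hpos⟩
    have hzero : binomC u [0] = binomC v [0] := by omega
    have hzero_one : binomC u [0, 1] = binomC v [0, 1] := by
      rw [hone] at hpos
      omega
    have hone_zero : binomC u [1, 0] = binomC v [1, 0] := by
      have hu := binomC_pair_add_swap u (zero_ne_one (α := Fin 2))
      have hv := binomC_pair_add_swap v (zero_ne_one (α := Fin 2))
      rw [hone, hzero, ← hv] at hu
      omega
    have hsingle : ∀ a : Fin 2, binomC u [a] = binomC v [a] := by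
      intro a
      fin_cases a <;> assumption
    intro x hx
    match x, hx with
    | [], _ => simp only [binomC_nil_right]
    | [a], _ => exact hsingle a
    | [a, b], _ =>
      by_cases hab : a = b
      · rw [hab, binomC_pair_self, binomC_pair_self, hsingle]
      · fin_cases a <;> fin_cases b <;> first | assumption | exact absurd rfl hab

/-- Equivalence of two words that occur as factors of given sequences. -/
lemma binEq2_iff_of_letters {u v : List (Fin 2)} {f : ℕ → ℕ} {s t n : ℕ}
    (hun : u.length = n) (hvn : v.length = n) (hu : ∀ i < n, letters u i = f (s + i))
    (hv : ∀ i < n, letters v i = f (t + i)) :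
    binEq2 u v ↔ letterSum f s n = letterSum f t n ∧ positionSum f s n = positionSum f t n := by
  have hu' : ∀ i < n, letters u (0 + i) = f (s + i) := by simpa using hu
  have hv' : ∀ i < n, letters v (0 + i) = f (t + i) := by simpa using hv
  rw [binEq2_iff, hun, hvn, letterSum_congr hu', letterSum_congr hv', positionSum_congr hu',
    positionSum_congr hv']
  simp

/-- The sequence obtained by replacing each letter `a` of `x` by the block `0 a 1`. -/
def blockSeq (x : ℕ → ℕ) (i : ℕ) : ℕ :=
  if i % 3 = 0 then 0 else if i % 3 = 1 then x (i / 3) else 1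

lemma hWord_cons (a : Fin 2) (w : List (Fin 2)) : hWord (a :: w) = 0 :: a :: 1 :: hWord w := by
  fin_cases a <;> rfl

lemma length_hWord (w : List (Fin 2)) : (hWord w).length = 3 * w.length := by
  induction w with
  | nil => rfl
  | cons a w ih =>
    simp only [hWord_cons, List.length_cons, ih]
    ring

lemma letters_hWord (w : List (Fin 2)) (i : ℕ) (hi : i < (hWord w).length) :
    letters (hWord w) i = blockSeq (letters w) i := by
  induction w generalizing i with
  | nil => simp [length_hWord] at hi
  | cons a w ih =>
    rw [hWord_cons] at hi ⊢
    match i with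
    | 0 => rfl
    | 1 => rfl
    | 2 => rfl
    | j + 3 =>
      simp only [List.length_cons] at hi
      simp only [letters_cons_succ, ih j (by omega), blockSeq, Nat.add_mod_right,
        Nat.add_div_right j (show 0 < 3 by norm_num)]

section BlockSeq

variable (x : ℕ → ℕ)

lemma blockSeq_three_mul (q : ℕ) : blockSeq x (3 * q) = 0 := by
  simp [blockSeq]

lemma blockSeq_three_mul_add_one (q : ℕ) : blockSeq x (3 * q + 1) = x q := by
  have h₁ : (3 * q + 1) % 3 = 1 := by omega
  have h₂ : (3 * q + 1) / 3 = q := by omega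
  simp [blockSeq, h₁, h₂]

lemma blockSeq_three_mul_add_two (q : ℕ) : blockSeq x (3 * q + 2) = 1 := by
  have h₁ : (3 * q + 2) % 3 = 2 := by omega
  simp [blockSeq, h₁]

lemma letterSum_blockSeq_three_mul (s m : ℕ) :
    letterSum (blockSeq x) s (3 * m) = letterSum x ((s + 1) / 3) m + m := by
  induction m with
  | zero => rfl
  | succ m ih =>
    rw [mul_add_one, letterSum_succ, letterSum_succ, letterSum_succ, letterSum_succ, ih]
    obtain ⟨q, rfl | rfl | rfl⟩ : ∃ q, s = 3 * q ∨ s = 3 * q + 1 ∨ s = 3 * q + 2 :=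
      ⟨s / 3, by omega⟩
    · rw [show 3 * q + 3 * m = 3 * (q + m) by ring,
        show 3 * q + (3 * m + 1) = 3 * (q + m) + 1 by ring,
        show 3 * q + (3 * m + 2) = 3 * (q + m) + 2 by ring,
        show (3 * q + 1) / 3 = q by omega,
        blockSeq_three_mul, blockSeq_three_mul_add_one, blockSeq_three_mul_add_two]
      ring
    · rw [show 3 * q + 1 + 3 * m = 3 * (q + m) + 1 by ring,
        show 3 * q + 1 + (3 * m + 1) = 3 * (q + m) + 2 by ring,
        show 3 * q + 1 + (3 * m + 2) = 3 * (q + m + 1) by ring,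
        show (3 * q + 1 + 1) / 3 = q by omega,
        blockSeq_three_mul, blockSeq_three_mul_add_one, blockSeq_three_mul_add_two]
      ring
    · rw [show 3 * q + 2 + 3 * m = 3 * (q + m) + 2 by ring,
        show 3 * q + 2 + (3 * m + 1) = 3 * (q + m + 1) by ring,
        show 3 * q + 2 + (3 * m + 2) = 3 * (q + 1 + m) + 1 by ring,
        show (3 * q + 2 + 1) / 3 = q + 1 by omega,
        blockSeq_three_mul, blockSeq_three_mul_add_one, blockSeq_three_mul_add_two]
      ring

/-- In a factor of length `3 * m` starting at `s`, the letters of `x` sit at the positions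
congruent to `2 * s + 1` and the letters `1` ending a block at those congruent to
`2 * s + 2` modulo `3`. -/
lemma positionSum_blockSeq_three_mul (s m : ℕ) :
    positionSum (blockSeq x) s (3 * m) =
      3 * positionSum x ((s + 1) / 3) m + (2 * s + 1) % 3 * letterSum x ((s + 1) / 3) m +
        ∑ i ∈ Finset.range m, (3 * i + (2 * s + 2) % 3) := by
  induction m with
  | zero => rfl
  | succ m ih =>
    rw [mul_add_one, positionSum_succ, positionSum_succ, positionSum_succ, letterSum_succ,
      positionSum_succ, ih, Finset.sum_range_succ]
    obtain ⟨q, rfl | rfl | rfl⟩ : ∃ q, s = 3 * q ∨ s = 3 * q + 1 ∨ s = 3 * q + 2 :=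
      ⟨s / 3, by omega⟩
    · rw [show 3 * q + 3 * m = 3 * (q + m) by ring,
        show 3 * q + (3 * m + 1) = 3 * (q + m) + 1 by ring,
        show 3 * q + (3 * m + 2) = 3 * (q + m) + 2 by ring,
        show (3 * q + 1) / 3 = q by omega,
        show (2 * (3 * q) + 1) % 3 = 1 by omega, show (2 * (3 * q) + 2) % 3 = 2 by omega,
        blockSeq_three_mul, blockSeq_three_mul_add_one, blockSeq_three_mul_add_two]
      ring
    · rw [show 3 * q + 1 + 3 * m = 3 * (q + m) + 1 by ring,
        show 3 * q + 1 + (3 * m + 1) = 3 * (q + m) + 2 by ring,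
        show 3 * q + 1 + (3 * m + 2) = 3 * (q + m + 1) by ring,
        show (3 * q + 1 + 1) / 3 = q by omega,
        show (2 * (3 * q + 1) + 1) % 3 = 0 by omega, show (2 * (3 * q + 1) + 2) % 3 = 1 by omega,
        blockSeq_three_mul, blockSeq_three_mul_add_one, blockSeq_three_mul_add_two]
      ring
    · rw [show 3 * q + 2 + 3 * m = 3 * (q + m) + 2 by ring,
        show 3 * q + 2 + (3 * m + 1) = 3 * (q + m + 1) by ring,
        show 3 * q + 2 + (3 * m + 2) = 3 * (q + 1 + m) + 1 by ring,
        show (3 * q + 2 + 1) / 3 = q + 1 by omega,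
        show (2 * (3 * q + 2) + 1) % 3 = 2 by omega, show (2 * (3 * q + 2) + 2) % 3 = 0 by omega,
        blockSeq_three_mul, blockSeq_three_mul_add_one, blockSeq_three_mul_add_two]
      ring

/-- Modulo `3`, every letter of `x` has the same weight in `positionSum`. -/
lemma positionSum_blockSeq_modEq (s n : ℕ) :
    positionSum (blockSeq x) s n ≡
      (2 * s + 1) * letterSum (blockSeq x) s n + (n + s % 3) / 3 [MOD 3] := by
  induction n with
  | zero =>
    have : s % 3 / 3 = 0 := by omega
    simp [positionSum, letterSum, this, Nat.ModEq]
  | succ n ih =>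
    rw [positionSum_succ, letterSum_succ]
    have key : n * blockSeq x (s + n) + (n + s % 3) / 3 ≡
        (2 * s + 1) * blockSeq x (s + n) + (n + 1 + s % 3) / 3 [MOD 3] := by
      obtain ⟨q, hq | hq | hq⟩ :
          ∃ q, s + n = 3 * q ∨ s + n = 3 * q + 1 ∨ s + n = 3 * q + 2 := ⟨(s + n) / 3, by omega⟩
      · rw [hq, blockSeq_three_mul]
        unfold Nat.ModEq
        omega
      · rw [hq, blockSeq_three_mul_add_one]
        refine Nat.ModEq.add (Nat.ModEq.mul_right _ ?_) ?_ <;> unfold Nat.ModEq <;> omega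
      · rw [hq, blockSeq_three_mul_add_two]
        unfold Nat.ModEq
        omega
    calc positionSum (blockSeq x) s n + n * blockSeq x (s + n)
        ≡ (2 * s + 1) * letterSum (blockSeq x) s n + (n + s % 3) / 3 + n * blockSeq x (s + n)
          [MOD 3] := ih.add_right _
      _ = (2 * s + 1) * letterSum (blockSeq x) s n +
          (n * blockSeq x (s + n) + (n + s % 3) / 3) := by ring
      _ ≡ (2 * s + 1) * letterSum (blockSeq x) s n +
          ((2 * s + 1) * blockSeq x (s + n) + (n + 1 + s % 3) / 3) [MOD 3] := key.add_left _
      _ = _ := by ring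

end BlockSeq

/-- The period of a 2-binomial cube in a concatenation of blocks `0 a 1` is divisible by `3`. -/
lemma three_dvd_of_blockSeq_cube {x : ℕ → ℕ} {s n : ℕ}
    (hS₁ : letterSum (blockSeq x) s n = letterSum (blockSeq x) (s + n) n)
    (hS₂ : letterSum (blockSeq x) (s + n) n = letterSum (blockSeq x) (s + 2 * n) n)
    (hP₁ : positionSum (blockSeq x) s n = positionSum (blockSeq x) (s + n) n)
    (hP₂ : positionSum (blockSeq x) (s + n) n = positionSum (blockSeq x) (s + 2 * n) n) :
    3 ∣ n := by
  have h₀ := positionSum_blockSeq_modEq x s n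
  have h₁ := positionSum_blockSeq_modEq x (s + n) n
  have h₂ := positionSum_blockSeq_modEq x (s + 2 * n) n
  rw [hP₁, hS₁] at h₀
  rw [← hP₂, ← hS₂] at h₂
  generalize letterSum (blockSeq x) (s + n) n = S at *
  generalize positionSum (blockSeq x) (s + n) n = P at *
  have reduce : ∀ t, P ≡ (2 * t + 1) * S + (n + t % 3) / 3 [MOD 3] →
      t % 3 = 0 ∧ P % 3 = (S + n / 3) % 3 ∨ t % 3 = 1 ∧ P % 3 = (n + 1) / 3 % 3 ∨
        t % 3 = 2 ∧ P % 3 = (2 * S + (n + 2) / 3) % 3 := by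
    intro t ht
    have ht' : P % 3 = ((2 * (t % 3) + 1) * S + (n + t % 3) / 3) % 3 := by
      refine ht.trans ((Nat.ModEq.mul_right S ?_).add_right _)
      unfold Nat.ModEq
      omega
    obtain hr | hr | hr : t % 3 = 0 ∨ t % 3 = 1 ∨ t % 3 = 2 := by omega
    all_goals
      rw [hr] at ht'
      omega
  replace h₀ := reduce _ h₀
  replace h₁ := reduce _ h₁
  replace h₂ := reduce _ h₂
  omega

/-- Equivalence of two factors whose starting points agree modulo `3` descends to `x`. -/
lemma sums_eq_of_blockSeq {x : ℕ → ℕ} {s t m : ℕ} (hst : s % 3 = t % 3)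
    (hS : letterSum (blockSeq x) s (3 * m) = letterSum (blockSeq x) t (3 * m))
    (hP : positionSum (blockSeq x) s (3 * m) = positionSum (blockSeq x) t (3 * m)) :
    letterSum x ((s + 1) / 3) m = letterSum x ((t + 1) / 3) m ∧
      positionSum x ((s + 1) / 3) m = positionSum x ((t + 1) / 3) m := by
  rw [letterSum_blockSeq_three_mul, letterSum_blockSeq_three_mul, add_left_inj] at hS
  rw [positionSum_blockSeq_three_mul, positionSum_blockSeq_three_mul, hS,
    show (2 * s + 1) % 3 = (2 * t + 1) % 3 by omega,
    show (2 * s + 2) % 3 = (2 * t + 2) % 3 by omega, add_left_inj, add_left_inj] at hP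
  exact ⟨hS, by omega⟩

lemma letters_take_drop (w : List (Fin 2)) (k m i : ℕ) (hi : i < m) :
    letters ((w.drop k).take m) i = letters w (k + i) := by
  simp [letters, List.getD_eq_getElem?_getD, hi]

/-- A 2-binomial cube in terms of letter sums and position sums. -/
lemma hasBinomialCube_iff (w : List (Fin 2)) :
    hasBinomialCube w ↔ ∃ s n, 0 < n ∧ s + 3 * n ≤ w.length ∧
      (letterSum (letters w) s n = letterSum (letters w) (s + n) n ∧
        positionSum (letters w) s n = positionSum (letters w) (s + n) n) ∧
      (letterSum (letters w) (s + n) n = letterSum (letters w) (s + 2 * n) n ∧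
        positionSum (letters w) (s + n) n = positionSum (letters w) (s + 2 * n) n) := by
  have factor : ∀ s n, s + n ≤ w.length → ((w.drop s).take n).length = n := by
    intro s n hsn
    simp
    omega
  constructor
  · rintro ⟨u, v, t, hu, ⟨a, b, rfl⟩, huv, hvt⟩
    have hvu := ((binEq2_iff _ _).1 huv).1
    have htu := ((binEq2_iff _ _).1 hvt).1
    refine ⟨a.length, u.length, List.length_pos_iff.2 hu, ?_, ?_, ?_⟩
    · simp
      omega
    · refine (binEq2_iff_of_letters rfl hvu.symm ?_ ?_).1 huv <;> intro i hi
      · simp [letters, List.getD_eq_getElem?_getD, List.getElem?_append, hi]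
      · have : i < v.length := by omega
        simp [letters, List.getD_eq_getElem?_getD, List.getElem?_append, this, add_assoc]
    · refine (binEq2_iff_of_letters hvu.symm (htu.symm.trans hvu.symm) ?_ ?_).1 hvt <;>
        intro i hi
      · have : i < v.length := by omega
        simp [letters, List.getD_eq_getElem?_getD, List.getElem?_append, this, add_assoc]
      · have : i < t.length := by omega
        simp [letters, List.getD_eq_getElem?_getD, List.getElem?_append, this, add_assoc,
          two_mul, hvu]
  · rintro ⟨s, n, hn, hle, huv, hvt⟩
    refine ⟨(w.drop s).take n, (w.drop (s + n)).take n, (w.drop (s + 2 * n)).take n, ?_, ?_,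
      ?_, ?_⟩
    · rw [← List.length_pos_iff, factor _ _ (by omega)]
      exact hn
    · refine ⟨w.take s, w.drop (s + 3 * n), ?_⟩
      have split : ∀ k, (w.drop k).take n ++ w.drop (k + n) = w.drop k := by
        intro k
        rw [← List.drop_drop, List.take_append_drop]
      rw [show s + 3 * n = s + 2 * n + n by ring, List.append_assoc, List.append_assoc,
        List.append_assoc, split, show s + 2 * n = s + n + n by ring, split, split,
        List.take_append_drop]
    · exact (binEq2_iff_of_letters (factor _ _ (by omega)) (factor _ _ (by omega))
        (letters_take_drop _ _ _) (letters_take_drop _ _ _)).2 huv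
    · exact (binEq2_iff_of_letters (factor _ _ (by omega)) (factor _ _ (by omega))
        (letters_take_drop _ _ _) (letters_take_drop _ _ _)).2 hvt

/-- The morphism h is 2-binomial-cube-free. -/
theorem h_is_2binomial_cube_free (w : List (Fin 2)) (hw : ¬ hasBinomialCube w) :
    ¬ hasBinomialCube (hWord w) := by
  contrapose! hw
  obtain ⟨s, n, hn, hle, ⟨hS₁, hP₁⟩, hS₂, hP₂⟩ := (hasBinomialCube_iff _).1 hw
  have hletters : ∀ t, t + n ≤ (hWord w).length →
      ∀ i < n, letters (hWord w) (t + i) = blockSeq (letters w) (t + i) :=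
    fun t ht i hi => letters_hWord w _ (by omega)
  have hl₀ := hletters s (by omega)
  have hl₁ := hletters (s + n) (by omega)
  have hl₂ := hletters (s + 2 * n) (by omega)
  rw [letterSum_congr hl₀, letterSum_congr hl₁] at hS₁
  rw [letterSum_congr hl₁, letterSum_congr hl₂] at hS₂
  rw [positionSum_congr hl₀, positionSum_congr hl₁] at hP₁
  rw [positionSum_congr hl₁, positionSum_congr hl₂] at hP₂
  obtain ⟨m, rfl⟩ := three_dvd_of_blockSeq_cube hS₁ hS₂ hP₁ hP₂
  rw [length_hWord] at hle
  refine (hasBinomialCube_iff w).2 ⟨(s + 1) / 3, m, by omega, by omega, ?_, ?_⟩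
  · have := sums_eq_of_blockSeq (by omega) hS₁ hP₁
    rwa [show (s + 3 * m + 1) / 3 = (s + 1) / 3 + m by omega] at this
  · have := sums_eq_of_blockSeq (by omega) hS₂ hP₂
    rwa [show (s + 3 * m + 1) / 3 = (s + 1) / 3 + m by omega,
      show (s + 2 * (3 * m) + 1) / 3 = (s + 1) / 3 + 2 * m by omega] at this
end

section
/- Erasing all 1's from the ternary Thue–Morse word yields the periodic word (02)^ω: for every n ∈ ℕ, the word e(g^n(0)) obtained by applying the erasing morphism e to g^n(0) has its k-th letter (0-indexed) equal to 0 when k is even and equal to 2 when k is odd, for every position k < |e(g^n(0))|. -/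
/-- The morphism g : 0 ↦ 012, 1 ↦ 02, 2 ↦ 1. -/
def g : Fin 3 → List (Fin 3) := ![[0,1,2],[0,2],[1]]

/-- Apply the morphism g to a word. -/
def gWord (w : List (Fin 3)) : List (Fin 3) := w.flatMap g

/-- The prefix g^n(0) of the ternary Thue–Morse word. -/
def gPow (n : ℕ) : List (Fin 3) := gWord^[n] [0]

/-- The erasing morphism e : 0 ↦ 0, 1 ↦ ε, 2 ↦ 2. -/
def e : Fin 3 → List (Fin 3) := ![[0], ([] : List (Fin 3)), [2]]

/-- Apply the morphism e to a word. -/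
def eWord (w : List (Fin 3)) : List (Fin 3) := w.flatMap e

/-- The composite of `g` and `e` sends 0 and 1 to 02 and 2 to the empty word, so every word in its
image is a power of 02. -/
theorem getElem_eWord_gWord (w : List (Fin 3)) (k : ℕ) (hk : k < (eWord (gWord w)).length) :
    (eWord (gWord w))[k] = if k % 2 = 0 then (0 : Fin 3) else 2 := by
  induction w generalizing k with
  | nil => simp [gWord, eWord] at hk
  | cons a w ih =>
    have h_cons : eWord (gWord (a :: w)) = eWord (g a) ++ eWord (gWord w) := by
      simp [gWord, eWord]
    have h_image : eWord (g a) = [0, 2] ∨ eWord (g a) = [] := by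
      clear h_cons hk; revert a; decide
    rcases h_image with h | h
    · have h_eq : eWord (gWord (a :: w)) = 0 :: 2 :: eWord (gWord w) := by simp [h_cons, h]
      match k with
      | 0 => simp [h_eq]
      | 1 => simp [h_eq]
      | k + 2 => simpa [h_eq] using ih k (by simpa [h_eq] using hk)
    · have h_eq : eWord (gWord (a :: w)) = eWord (gWord w) := by simp [h_cons, h]
      simpa only [h_eq] using ih k (h_eq ▸ hk)

/-- Erasing the 1's from the ternary Thue–Morse word gives (02)^ω. -/
theorem erase_ones_gives_alternating
    (n k : ℕ) (hk : k < (eWord (gPow n)).length) :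
    (eWord (gPow n))[k]'hk = if k % 2 = 0 then (0 : Fin 3) else 2 := by
  cases n with
  | zero =>
    have h_eq : eWord (gPow 0) = [0] := rfl
    have h_zero : k = 0 := by simpa [h_eq] using hk
    subst h_zero
    rfl
  | succ n =>
    have h_eq : gPow (n + 1) = gWord (gPow n) := Function.iterate_succ_apply' gWord n [0]
    simpa only [h_eq] using getElem_eWord_gWord (gPow n) k (h_eq ▸ hk)
end

section
/- A word u over {0,1,2} is a factor of the ternary Thue–Morse word x = g^ω(0) if and only if its mirror image (reversal) is a factor of x: u is a contiguous subword of g^n(0) for some n ∈ ℕ if and only if the reverse of u is a contiguous subword of g^m(0) for some m ∈ ℕ. -/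
theorem gWord_append (u v : List (Fin 3)) : gWord (u ++ v) = gWord u ++ gWord v := by
  simp [gWord]

theorem gPow_succ (n : ℕ) : gPow (n + 1) = gWord (gPow n) :=
  Function.iterate_succ_apply' gWord n [0]

theorem gPow_succ_append_zero_prefix (n : ℕ) : gPow (n + 1) ++ [0] <+: gPow (n + 2) := by
  induction n with
  | zero => decide
  | succ n ih =>
    obtain ⟨r, hr⟩ := ih
    refine ⟨[1, 2] ++ gWord r, ?_⟩
    have hg := congrArg gWord hr
    rw [gWord_append, gWord_append, ← gPow_succ, ← gPow_succ] at hg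
    rw [← hg]
    simp [gWord, g]

theorem gPow_prefix_succ (n : ℕ) : gPow n <+: gPow (n + 1) := by
  cases n with
  | zero => decide
  | succ n => exact (List.prefix_append _ _).trans (gPow_succ_append_zero_prefix n)

theorem gPow_prefix_of_le {m n : ℕ} (h : m ≤ n) : gPow m <+: gPow n := by
  induction h with
  | refl => exact List.prefix_rfl
  | step _ ih => exact ih.trans (gPow_prefix_succ _)

/-- The square of g is conjugate, by the letter 0, to its mirror image. -/
theorem zero_cons_reverse_gWord_gWord_reverse (u : List (Fin 3)) :
    0 :: (gWord (gWord u.reverse)).reverse = gWord (gWord u) ++ [0] := by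
  induction u with
  | nil => rfl
  | cons a u ih =>
    have ha : 0 :: (gWord (gWord [a])).reverse = gWord (gWord [a]) ++ [0] := by
      revert a; decide
    rw [← List.singleton_append (l := u), gWord_append, gWord_append, List.append_assoc, ← ih,
      List.reverse_append, gWord_append, gWord_append, List.reverse_append, ← List.cons_append,
      List.reverse_singleton, ha]
    simp

theorem gWord_gWord_append_zero (u : List (Fin 3)) :
    ∃ r, gWord (gWord u) ++ [0] = 0 :: r :=
  ⟨_, (zero_cons_reverse_gWord_gWord_reverse u).symm⟩

theorem exists_reverse_gPow_two_mul_infix (n : ℕ) :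
    ∃ m : ℕ, (gPow (2 * n)).reverse <:+: gPow m := by
  induction n with
  | zero => exact ⟨0, by decide⟩
  | succ n ih =>
    obtain ⟨m, s, t, h⟩ := ih
    refine ⟨m + 3, List.IsInfix.trans ?_ (gPow_succ_append_zero_prefix (m + 1)).isInfix⟩
    obtain ⟨r, hr⟩ := gWord_gWord_append_zero t
    have key := zero_cons_reverse_gWord_gWord_reverse (gPow (2 * n)).reverse
    rw [List.reverse_reverse, ← gPow_succ, ← gPow_succ] at key
    refine ⟨gWord (gWord s) ++ [0], r, ?_⟩
    rw [gPow_succ (m + 1), gPow_succ m, ← h]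
    simp only [gWord_append, List.append_assoc, hr]
    rw [← List.singleton_append (l := r), ← List.append_assoc (gWord (gWord (gPow _).reverse)),
      ← key]
    simp [Nat.mul_succ]

theorem exists_reverse_infix_gPow {u : List (Fin 3)} (h : ∃ n : ℕ, u <:+: gPow n) :
    ∃ m : ℕ, u.reverse <:+: gPow m := by
  obtain ⟨n, hn⟩ := h
  obtain ⟨m, hm⟩ := exists_reverse_gPow_two_mul_infix n
  have hu : u <:+: gPow (2 * n) := hn.trans (gPow_prefix_of_le (by omega)).isInfix
  exact ⟨m, (List.reverse_infix.mpr hu).trans hm⟩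

/-- The factors of the ternary Thue–Morse word are closed under mirror image. -/
theorem ternary_thue_morse_mirror_invariant (u : List (Fin 3)) :
    (∃ n : ℕ, u <:+: gPow n) ↔ (∃ m : ℕ, u.reverse <:+: gPow m) := by
  refine ⟨exists_reverse_infix_gPow, fun h => ?_⟩
  simpa using exists_reverse_infix_gPow h
end

section
/- Let u, v be nonempty abelian equivalent words over {0,1,2} such that u·v is a factor of x = g^ω(0). Then there exists an integer i ≥ 1 such that either e(u) = e(v) = (02)^i or e(u) = e(v) = (20)^i, where (02)^i and (20)^i denote i concatenated copies of the word 02, respectively 20. -/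
theorem eWord_append (u v : List (Fin 3)) : eWord (u ++ v) = eWord u ++ eWord v := by
  simp [eWord]

theorem eq_zero_or_two_of_mem_eWord {w : List (Fin 3)} : ∀ a ∈ eWord w, a = 0 ∨ a = 2 := by
  intro a ha
  obtain ⟨b, -, hb⟩ := List.mem_flatMap.1 ha
  fin_cases b <;> simp_all [e]

theorem count_eWord (w : List (Fin 3)) {a : Fin 3} (ha : a = 0 ∨ a = 2) :
    (eWord w).count a = w.count a := by
  induction w with
  | nil => rfl
  | cons b w ih =>
    simp only [eWord, List.flatMap_cons, List.count_append] at ih ⊢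
    rw [ih]
    rcases ha with rfl | rfl <;> fin_cases b <;> simp [e, add_comm]

theorem isChain_ne_two_cons_eWord_gWord (w : List (Fin 3)) :
    (2 :: eWord (gWord w)).IsChain (· ≠ ·) := by
  induction w with
  | nil => simp [eWord, gWord]
  | cons a w ih =>
    simp only [eWord, gWord, List.flatMap_cons, List.flatMap_append] at ih ⊢
    fin_cases a <;> simpa [e, g] using ih

theorem isChain_ne_eWord_gPow (n : ℕ) : (eWord (gPow n)).IsChain (· ≠ ·) := by
  cases n with
  | zero => simp [gPow, eWord, e]
  | succ n =>
    rw [gPow, Function.iterate_succ_apply']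
    exact (isChain_ne_two_cons_eWord_gWord _).tail

/-- If the letters 0 and 2 alternate in `w`, then `11` does not occur in `g(w)`. -/
theorem isChain_gWord_of_isChain_eWord (w : List (Fin 3))
    (h : (eWord w).IsChain (· ≠ ·)) :
    (gWord w).IsChain (fun a b => ¬(a = 1 ∧ b = 1)) := by
  induction w with
  | nil => simp [gWord]
  | cons a w ih =>
    have hw : (eWord w).IsChain (· ≠ ·) := by
      rw [← List.singleton_append, eWord_append] at h
      exact h.right_of_append
    specialize ih hw
    cases w with
    | nil => fin_cases a <;> simp [gWord, g]
    | cons b w =>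
      simp only [eWord, gWord, List.flatMap_cons] at ih h ⊢
      fin_cases a <;> fin_cases b <;> simp_all [e, g]

theorem isChain_gPow (n : ℕ) : (gPow n).IsChain (fun a b => ¬(a = 1 ∧ b = 1)) := by
  cases n with
  | zero => simp [gPow]
  | succ n =>
    have h := isChain_gWord_of_isChain_eWord _ (isChain_ne_eWord_gPow n)
    rwa [gPow, Function.iterate_succ_apply']

/-- A prefix `l` of an alternating word over `{a, b}` that does not start with `b` is either
a power of `ab`, or has one more `a` than `b` and ends with `a`. -/
theorem alternating_prefix {α : Type*} [DecidableEq α] {a b : α} (hab : a ≠ b) (m : List α) :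
    ∀ l : List α, (∀ x ∈ l, x = a ∨ x = b) → (b :: (l ++ m)).IsChain (· ≠ ·) →
      (l.count a = l.count b ∧ l = (List.replicate (l.count a) [a, b]).flatten ∧
        (b :: m).IsChain (· ≠ ·)) ∨
      (l.count a = l.count b + 1 ∧ (a :: m).IsChain (· ≠ ·))
  | [], _, h => by simpa using h
  | [x], hl, h => by
    have hx : x = a := by
      simp only [List.singleton_append, List.isChain_cons_cons] at h
      exact (hl x (by simp)).resolve_right (Ne.symm h.1)
    subst hx
    right
    simp_all
  | x :: y :: l, hl, h => by
    simp only [List.cons_append, List.isChain_cons_cons] at h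
    obtain ⟨hbx, hxy, h⟩ := h
    obtain rfl : x = a := (hl x (by simp)).resolve_right (Ne.symm hbx)
    obtain rfl : y = b := (hl y (by simp)).resolve_left (Ne.symm hxy)
    have ih := alternating_prefix hab m l (fun z hz => hl z (by simp [hz])) h
    have hx : (x :: y :: l).count x = l.count x + 1 := by simp [Ne.symm hab]
    have hy : (x :: y :: l).count y = l.count y + 1 := by simp [hab]
    rw [hx, hy]
    rcases ih with ⟨h₁, h₂, h₃⟩ | ⟨h₁, h₃⟩
    · refine Or.inl ⟨by omega, ?_, h₃⟩
      rw [List.replicate_succ, List.flatten_cons, ← h₂]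
      rfl
    · exact Or.inr ⟨by omega, h₃⟩

theorem alternating_abelian_square {α : Type*} [DecidableEq α] {a b : α} (hab : a ≠ b)
    {l m : List α} (hl : ∀ x ∈ l, x = a ∨ x = b) (hm : ∀ x ∈ m, x = a ∨ x = b)
    (ha : l.count a = m.count a) (hb : l.count b = m.count b)
    (h : (b :: (l ++ m)).IsChain (· ≠ ·)) :
    l = (List.replicate (l.count a) [a, b]).flatten ∧
      m = (List.replicate (l.count a) [a, b]).flatten := by
  rcases alternating_prefix hab m l hl h with ⟨h₁, h₂, h₃⟩ | ⟨h₁, h₃⟩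
  · refine ⟨h₂, ?_⟩
    rcases alternating_prefix hab [] m hm (by simpa using h₃) with ⟨-, h₄, -⟩ | ⟨h₄, -⟩
    · rwa [ha]
    · omega
  · rcases alternating_prefix hab.symm [] m (fun x hx => (hm x hx).symm) (by simpa using h₃)
      with ⟨h₄, -⟩ | ⟨h₄, -⟩ <;> omega

theorem eq_one_of_eWord_eq_nil {w : List (Fin 3)} (h : eWord w = []) : ∀ a ∈ w, a = 1 := by
  intro a ha
  have := List.flatMap_eq_nil_iff.1 h a ha
  fin_cases a <;> simp_all [e]

/-- Erasing the 1's from an abelian square factor of the ternary Thue–Morse word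
gives (02)^i (02)^i or (20)^i (20)^i. -/
theorem erase_ones_of_abelian_square
    (u v : List (Fin 3)) (hu : u ≠ []) (hv : v ≠ [])
    (hab : ∀ a : Fin 3, u.count a = v.count a)
    (hfac : ∃ n : ℕ, (u ++ v) <:+: gPow n) :
    ∃ i : ℕ, 1 ≤ i ∧
      ((eWord u = (List.replicate i ([0,2] : List (Fin 3))).flatten ∧
        eWord v = (List.replicate i ([0,2] : List (Fin 3))).flatten) ∨
       (eWord u = (List.replicate i ([2,0] : List (Fin 3))).flatten ∧
        eWord v = (List.replicate i ([2,0] : List (Fin 3))).flatten)) := by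
  obtain ⟨n, hn⟩ := hfac
  have hchain : (eWord u ++ eWord v).IsChain (· ≠ ·) := by
    obtain ⟨s, t, hst⟩ := hn
    have h := isChain_ne_eWord_gPow n
    rw [← hst, eWord_append, eWord_append, eWord_append] at h
    exact h.left_of_append.right_of_append
  have h0 : (eWord u).count 0 = (eWord v).count 0 := by
    simpa only [count_eWord _ (Or.inl rfl)] using hab 0
  have h2 : (eWord u).count 2 = (eWord v).count 2 := by
    simpa only [count_eWord _ (Or.inr rfl)] using hab 2
  have hmu := eq_zero_or_two_of_mem_eWord (w := u)
  have hmv := eq_zero_or_two_of_mem_eWord (w := v)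
  have hne : eWord u ≠ [] := by
    intro hnil
    have hnil' : eWord v = [] := by
      refine List.eq_nil_iff_forall_not_mem.2 fun a ha => ?_
      have hpos := List.count_pos_iff.2 ha
      rcases hmv a ha with rfl | rfl
      · rw [← h0, hnil] at hpos
        simp at hpos
      · rw [← h2, hnil] at hpos
        simp at hpos
    have h := (List.isChain_append.1 ((isChain_gPow n).infix hn)).2.2
    exact h _ (List.getLast_mem_getLast? hu) _ (List.head_mem_head? hv)
      ⟨eq_one_of_eWord_eq_nil hnil _ (List.getLast_mem hu),
        eq_one_of_eWord_eq_nil hnil' _ (List.head_mem hv)⟩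
  obtain ⟨c, l, hcl⟩ := List.exists_cons_of_ne_nil hne
  have hpos : ∀ {i : ℕ} {p : List (Fin 3)},
      eWord u = (List.replicate i p).flatten → 1 ≤ i := by
    intro i p h
    rcases Nat.eq_zero_or_pos i with rfl | hi
    · simp [h] at hne
    · exact hi
  rcases hmu c (by simp [hcl]) with rfl | rfl
  · have h := alternating_abelian_square (a := 0) (b := 2) (by decide) hmu hmv h0 h2
      (by rw [hcl] at hchain ⊢; exact List.isChain_cons_cons.2 ⟨by decide, hchain⟩)
    exact ⟨_, hpos h.1, Or.inl h⟩
  · have h := alternating_abelian_square (a := 2) (b := 0) (by decide)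
      (fun x hx => (hmu x hx).symm) (fun x hx => (hmv x hx).symm) h2 h0
      (by rw [hcl] at hchain ⊢; exact List.isChain_cons_cons.2 ⟨by decide, hchain⟩)
    exact ⟨_, hpos h.1, Or.inr h⟩
end

section
/- Every factor of the ternary Thue–Morse word is nearly balanced in 0's and 2's: for every n ∈ ℕ and every contiguous subword w of g^n(0), the absolute difference | |w|_0 − |w|_2 | is at most 1. -/
theorem count_prefix_image_letter (a : Fin 3) {p : List (Fin 3)} (hp : p <+: g a) :
    p.count 2 ≤ p.count 0 ∧ p.count 0 ≤ p.count 2 + 1 := by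
  have h : ∀ a : Fin 3, ∀ q ∈ (g a).inits, q.count 2 ≤ q.count 0 ∧ q.count 0 ≤ q.count 2 + 1 := by
    decide
  exact h a p (List.mem_inits p (g a) |>.2 hp)

theorem count_image_letter (a : Fin 3) : (g a).count 0 = (g a).count 2 := by
  revert a
  decide

/-- In every prefix of an image under `g`, the letters 0 and 2 occur alternately, starting with
0, so the number of 0's exceeds the number of 2's by zero or one. -/
theorem count_prefix_gWord (u : List (Fin 3)) {p : List (Fin 3)} (hp : p <+: gWord u) :
    p.count 2 ≤ p.count 0 ∧ p.count 0 ≤ p.count 2 + 1 := by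
  induction u generalizing p with
  | nil =>
    obtain rfl : p = [] := List.prefix_nil.1 hp
    simp
  | cons a u ih =>
    have hp' : p <+: g a ++ gWord u := hp
    rcases List.prefix_or_prefix_of_prefix hp' (List.prefix_append _ _) with h | ⟨q, rfl⟩
    · exact count_prefix_image_letter a h
    · have hq := ih ((List.prefix_append_right_inj _).1 hp')
      have ha := count_image_letter a
      simp only [List.count_append]
      omega

theorem factor_gWord_nearly_balanced (u : List (Fin 3)) {w : List (Fin 3)} (hw : w <:+: gWord u) :
    |(w.count 0 : ℤ) - (w.count 2 : ℤ)| ≤ 1 := by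
  obtain ⟨s, t, h⟩ := hw
  have hs := count_prefix_gWord u (p := s) ⟨w ++ t, by simpa using h⟩
  have hsw := count_prefix_gWord u (p := s ++ w) ⟨t, h⟩
  simp only [List.count_append] at hsw
  rw [abs_le]
  omega

/-- Every factor of the ternary Thue–Morse word is nearly balanced in 0's and 2's. -/
theorem factors_nearly_balanced (n : ℕ) (w : List (Fin 3)) (hw : w <:+: gPow n) :
    |(w.count 0 : ℤ) - (w.count 2 : ℤ)| ≤ 1 := by
  cases n with
  | zero => exact factor_gWord_nearly_balanced [0] (hw.trans ⟨[], [1, 2], rfl⟩)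
  | succ n =>
    rw [gPow, Function.iterate_succ_apply'] at hw
    exact factor_gWord_nearly_balanced _ hw
end
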